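/- For every integer n ≥ 3, in the set S_n(132,213,231): f_{123}(S_n(132,213,231)) = f_{312}(S_n(132,213,231)) = binom(n+1, 4), and 12·f_{321}(S_n(132,213,231)) = n(n−2)(n−1)² (i.e., f_{321}(S_n(132,213,231)) = n(n−2)(n−1)²/12). -/

import Mathlib

open Finset

/-- Number of occurrences of the length-3 pattern `q` (given by its sequence of values)
in the permutation `σ` of `Fin n`: triples of indices `ι 0 < ι 1 < ι 2` whose values under
`σ` are in the same relative order as the values of `q`. -/
def occ (n : ℕ) (q : Fin 3 → ℕ) (σ : Equiv.Perm (Fin n)) : ℕ :=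
  (Finset.univ.filter fun ι : Fin 3 → Fin n =>
    (∀ j l : Fin 3, j < l → ι j < ι l) ∧
    (∀ j l : Fin 3, q j < q l ↔ σ (ι j) < σ (ι l))).card

/-- The set `S_n(R)` of permutations of `{1,…,n}` avoiding every pattern in `R`. -/
def avoiders (n : ℕ) (R : List (Fin 3 → ℕ)) : Finset (Equiv.Perm (Fin n)) :=
  Finset.univ.filter fun σ => ∀ q ∈ R, occ n q σ = 0

/-- `f_q(S_n(R))`: the total number of occurrences of the pattern `q` among
all permutations in `S_n(R)`. -/
def fCnt (n : ℕ) (q : Fin 3 → ℕ) (R : List (Fin 3 → ℕ)) : ℕ :=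
  ∑ σ ∈ avoiders n R, occ n q σ

def p123 : Fin 3 → ℕ := ![1, 2, 3]
def p132 : Fin 3 → ℕ := ![1, 3, 2]
def p213 : Fin 3 → ℕ := ![2, 1, 3]
def p231 : Fin 3 → ℕ := ![2, 3, 1]
def p312 : Fin 3 → ℕ := ![3, 1, 2]
def p321 : Fin 3 → ℕ := ![3, 2, 1]

theorem occ_eq_sum (n : ℕ) (q : Fin 3 → ℕ) (hq : Function.Injective q) (σ : Equiv.Perm (Fin n)) :
    occ n q σ = ∑ i, ∑ j, ∑ l, if i < j ∧ j < l ∧ (q 0 < q 1 ↔ σ i < σ j) ∧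
      (q 0 < q 2 ↔ σ i < σ l) ∧ (q 1 < q 2 ↔ σ j < σ l) then 1 else 0 := by
  let e : (Fin 3 → Fin n) ≃ Fin n × Fin n × Fin n :=
    { toFun := fun ι => (ι 0, ι 1, ι 2)
      invFun := fun p => ![p.1, p.2.1, p.2.2]
      left_inv := fun ι => by ext k; fin_cases k <;> rfl
      right_inv := fun p => rfl }
  have h01 : q 0 ≠ q 1 := hq.ne (by decide)
  have h02 : q 0 ≠ q 2 := hq.ne (by decide)
  have h12 : q 1 ≠ q 2 := hq.ne (by decide)
  simp only [← Fintype.sum_prod_type']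
  rw [occ, Finset.card_filter]
  refine Fintype.sum_equiv e _ _ fun ι => ?_
  congr 1
  have key : ∀ a b : Fin n, a < b → (σ b < σ a ↔ ¬ σ a < σ b) := fun a b hab => by
    have : σ a ≠ σ b := σ.injective.ne hab.ne
    grind
  have qkey : ∀ a b : ℕ, a ≠ b → (b < a ↔ ¬ a < b) := fun a b hab => by omega
  simp only [Fin.forall_fin_succ, Fin.forall_fin_zero, eq_iff_iff]
  simp only [Fin.isValue, lt_self_iff_false, Fin.succ_zero_eq_one, Fin.succ_one_eq_two,
    IsEmpty.forall_iff, true_and, and_true, iff_self]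
  change _ ↔ ι 0 < ι 1 ∧ ι 1 < ι 2 ∧ (q 0 < q 1 ↔ σ (ι 0) < σ (ι 1)) ∧
    (q 0 < q 2 ↔ σ (ι 0) < σ (ι 2)) ∧ (q 1 < q 2 ↔ σ (ι 1) < σ (ι 2))
  constructor
  · grind
  · rintro ⟨hij, hjl, h1, h2, h3⟩
    have hil := hij.trans hjl
    rw [qkey _ _ h01, qkey _ _ h02, qkey _ _ h12, key _ _ hij, key _ _ hjl, key _ _ hil]
    have h20 : ¬ (2 : Fin 3) < 0 := by decide
    have h21 : ¬ (2 : Fin 3) < 1 := by decide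
    have h10 : ¬ (1 : Fin 3) < 0 := by decide
    grind

/-- The permutation of `Fin n` whose first `m` values are `n - 1, n - 2, …, n - m`, and whose
remaining values increase. -/
noncomputable def decrThenIncr (n : ℕ) (m : Fin n) : Equiv.Perm (Fin n) :=
  Equiv.ofBijective
    (fun i => if i < m then ⟨n - 1 - i, by omega⟩ else ⟨i - m, by omega⟩)
    (Finite.injective_iff_bijective.1 fun i j h => by
      ext
      split_ifs at h <;> simp only [Fin.mk.injEq, Fin.lt_def] at * <;> omega)

theorem decrThenIncr_lt_iff {n : ℕ} (m : Fin n) {i j : Fin n} (hij : i < j) :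
    decrThenIncr n m i < decrThenIncr n m j ↔ m ≤ i := by
  simp only [decrThenIncr, Equiv.ofBijective_apply]
  split_ifs <;> simp only [Fin.lt_def, Fin.le_def] at * <;> omega

theorem decrThenIncr_injective (n : ℕ) : Function.Injective (decrThenIncr n) := by
  have key : ∀ a b : Fin n, a < b → decrThenIncr n a ≠ decrThenIncr n b := fun a b hab h => by
    have h1 := decrThenIncr_lt_iff a hab
    have hs : a < (⟨a + 1, by omega⟩ : Fin n) := by simp [Fin.lt_def]
    have h2 := decrThenIncr_lt_iff a hs
    have h3 := decrThenIncr_lt_iff b hs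
    rw [← h, h2] at h3
    exact absurd (h3.1 le_rfl) (not_le.2 hab)
  intro a b h
  by_contra hne
  rcases lt_or_gt_of_ne hne with hab | hab
  · exact key _ _ hab h
  · exact key _ _ hab h.symm

theorem perm_eq_of_lt_iff {n : ℕ} {σ τ : Equiv.Perm (Fin n)}
    (h : ∀ i j, i < j → (σ i < σ j ↔ τ i < τ j)) : σ = τ := by
  have hmono : StrictMono (σ.symm.trans τ) := fun a b hab => by
    obtain ⟨i, rfl⟩ := σ.surjective a
    obtain ⟨j, rfl⟩ := σ.surjective b
    simp only [Equiv.trans_apply, Equiv.symm_apply_apply]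
    rcases lt_trichotomy i j with hij | rfl | hij
    · exact (h i j hij).1 hab
    · exact absurd hab (lt_irrefl _)
    · have := mt (h j i hij).2 hab.not_gt
      exact lt_of_le_of_ne (not_lt.1 this) (τ.injective.ne hij.ne')
  have hid : hmono.orderIsoOfSurjective _ (σ.symm.trans τ).surjective = OrderIso.refl _ :=
    Subsingleton.elim _ _
  ext i
  have := DFunLike.congr_fun hid (σ i)
  simpa using congrArg Fin.val this.symm

theorem occ_eq_zero_iff {n : ℕ} {q : Fin 3 → ℕ} (hq : Function.Injective q)
    (σ : Equiv.Perm (Fin n)) :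
    occ n q σ = 0 ↔ ∀ i j l, i < j → j < l → ¬ ((q 0 < q 1 ↔ σ i < σ j) ∧
      (q 0 < q 2 ↔ σ i < σ l) ∧ (q 1 < q 2 ↔ σ j < σ l)) := by
  rw [occ_eq_sum n q hq]
  simp [Finset.sum_eq_zero_iff]

theorem p123_injective : Function.Injective p123 := by decide
theorem p132_injective : Function.Injective p132 := by decide
theorem p213_injective : Function.Injective p213 := by decide
theorem p231_injective : Function.Injective p231 := by decide
theorem p312_injective : Function.Injective p312 := by decide
theorem p321_injective : Function.Injective p321 := by decide

theorem mem_avoiders_iff {n : ℕ} (σ : Equiv.Perm (Fin n)) :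
    σ ∈ avoiders n [p132, p213, p231] ↔ ∀ i j l, i < j → j < l →
      (σ i < σ j → σ j < σ l) ∧ (σ i < σ l → σ i < σ j) := by
  simp only [avoiders, Finset.mem_filter, Finset.mem_univ, true_and, List.forall_mem_cons,
    List.not_mem_nil, IsEmpty.forall_iff, implies_true, and_true,
    occ_eq_zero_iff p132_injective, occ_eq_zero_iff p213_injective,
    occ_eq_zero_iff p231_injective]
  simp only [p132, p213, p231, Matrix.cons_val]
  norm_num
  constructor
  · rintro ⟨h1, h2, h3⟩ i j l hij hjl
    have := h1 i j l hij hjl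
    have := h2 i j l hij hjl
    have := h3 i j l hij hjl
    have := σ.injective.ne hij.ne
    have := σ.injective.ne hjl.ne
    have := σ.injective.ne (hij.trans hjl).ne
    grind
  · intro h
    refine ⟨?_, ?_, ?_⟩ <;> intro i j l hij hjl <;> have := h i j l hij hjl <;> grind

theorem avoiders_eq_image (n : ℕ) (hn : 0 < n) :
    avoiders n [p132, p213, p231] = Finset.univ.image (decrThenIncr n) := by
  ext σ
  rw [mem_avoiders_iff]
  simp only [Finset.mem_image, Finset.mem_univ, true_and]
  constructor
  · intro h
    by_cases hex : ∃ i : Fin n, ∃ l, i < l ∧ σ i < σ l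
    · obtain ⟨m, ⟨l, hml, hσ⟩, hmin⟩ := WellFounded.has_min (wellFounded_lt (α := Fin n))
        {i | ∃ l, i < l ∧ σ i < σ l} hex
      refine ⟨m, perm_eq_of_lt_iff fun i j hij => ?_⟩
      rw [decrThenIncr_lt_iff m hij]
      have hm : ∀ j, m < j → σ m < σ j := fun j hj => by
        rcases lt_trichotomy j l with hjl | rfl | hjl
        · exact (h m j l hj hjl).2 hσ
        · exact hσ
        · exact hσ.trans ((h m l j hml hjl).1 hσ)
      constructor
      · intro hmi
        rcases hmi.eq_or_lt with rfl | hmi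
        · exact hm j hij
        · exact (h m i j hmi hij).1 (hm i hmi)
      · intro hlt
        exact not_lt.1 (hmin i ⟨j, hij, hlt⟩)
    · push Not at hex
      refine ⟨⟨n - 1, by omega⟩, perm_eq_of_lt_iff fun i j hij => ?_⟩
      rw [decrThenIncr_lt_iff _ hij]
      have := hex i j hij
      simp only [Fin.lt_def, Fin.le_def] at *
      omega
  · rintro ⟨m, rfl⟩ i j l hij hjl
    rw [decrThenIncr_lt_iff m hij, decrThenIncr_lt_iff m hjl, decrThenIncr_lt_iff m (hij.trans hjl)]
    exact ⟨fun hm => hm.trans hij.le, id⟩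

theorem sum_range_increasing (n : ℕ) (F : ℕ → ℕ → ℕ → ℕ) :
    (∑ i ∈ range n, ∑ j ∈ range n, ∑ l ∈ range n, if i < j ∧ j < l then F i j l else 0) =
      ∑ l ∈ range n, ∑ j ∈ range l, ∑ i ∈ range j, F i j l := by
  have aux : ∀ k ≤ n, ∀ G : ℕ → ℕ,
      (∑ i ∈ range n, if i < k then G i else 0) = ∑ i ∈ range k, G i := fun k hk G => by
    rw [← Finset.sum_filter]
    congr 1
    ext; simp; omega
  calc _ = ∑ l ∈ range n, ∑ j ∈ range n, ∑ i ∈ range n,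
        if i < j ∧ j < l then F i j l else 0 := by
        simp_rw [Finset.sum_comm (s := range n) (t := range n)
          (f := fun j l => if _ < j ∧ j < l then F _ j l else 0)]
        rw [Finset.sum_comm]
        exact Finset.sum_congr rfl fun l _ => Finset.sum_comm
    _ = _ := by
        refine Finset.sum_congr rfl fun l hl => ?_
        rw [← aux l (Finset.mem_range.1 hl).le]
        refine Finset.sum_congr rfl fun j hj => ?_
        split_ifs with hjl
        · rw [← aux j (Finset.mem_range.1 hj).le]
          simp [hjl]
        · simp [hjl]

theorem fCnt_eq_sum (n : ℕ) (hn : 0 < n) (q : Fin 3 → ℕ) (hq : Function.Injective q) :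
    fCnt n q [p132, p213, p231] = ∑ l ∈ range n, ∑ j ∈ range l, ∑ i ∈ range j,
      #{m ∈ range n | (q 0 < q 1 ↔ m ≤ i) ∧ (q 0 < q 2 ↔ m ≤ i) ∧ (q 1 < q 2 ↔ m ≤ j)} := by
  rw [fCnt, avoiders_eq_image n hn, Finset.sum_image (decrThenIncr_injective n).injOn,
    ← sum_range_increasing]
  have hocc : ∀ m : Fin n, occ n q (decrThenIncr n m) =
      ∑ i ∈ range n, ∑ j ∈ range n, ∑ l ∈ range n, if i < j ∧ j < l then
        (if (q 0 < q 1 ↔ m.val ≤ i) ∧ (q 0 < q 2 ↔ m.val ≤ i) ∧ (q 1 < q 2 ↔ m.val ≤ j)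
          then 1 else 0) else 0 := fun m => by
    rw [occ_eq_sum n q hq]
    simp only [← Fin.sum_univ_eq_sum_range (n := n)]
    refine Finset.sum_congr rfl fun i _ => Finset.sum_congr rfl fun j _ =>
      Finset.sum_congr rfl fun l _ => ?_
    by_cases hij : i < j
    · by_cases hjl : j < l
      · simp only [decrThenIncr_lt_iff m hij, decrThenIncr_lt_iff m hjl,
          decrThenIncr_lt_iff m (hij.trans hjl)]
        simp [hij, hjl]
      · simp [hjl]
    · simp [hij]
  simp only [hocc]
  rw [Finset.sum_comm' (t' := range n) (s' := fun _ => Finset.univ) (by simp)]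
  refine Finset.sum_congr rfl fun i _ => ?_
  rw [Finset.sum_comm]
  refine Finset.sum_congr rfl fun j _ => ?_
  rw [Finset.sum_comm]
  refine Finset.sum_congr rfl fun l _ => ?_
  split_ifs
  · rw [Finset.card_filter, ← Fin.sum_univ_eq_sum_range (n := n)]
  · simp

theorem sum_range_choose_succ (n k : ℕ) :
    ∑ i ∈ range n, (i + 1).choose (k + 1) = (n + 1).choose (k + 2) := by
  induction n with
  | zero => simp [Nat.choose_eq_zero_of_lt]
  | succ n ih => rw [Finset.sum_range_succ, ih, Nat.choose_succ_succ' (n + 1), add_comm]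

theorem sum_range_mul_sub (N l : ℕ) :
    6 * ∑ j ∈ range l, (j : ℤ) * (N - j) = l * (l - 1) * (3 * N - 2 * l + 1) := by
  induction l with
  | zero => simp
  | succ l ih => rw [Finset.sum_range_succ, mul_add, ih]; push_cast; ring

theorem sum_range_sum_range_mul_sub (N n : ℕ) :
    12 * ∑ l ∈ range n, ∑ j ∈ range l, (j : ℤ) * (N - j) =
      n * (n - 1) * (n - 2) * (2 * N - n + 1) := by
  induction n with
  | zero => simp
  | succ n ih =>
    rw [Finset.sum_range_succ, mul_add, ih]
    have := sum_range_mul_sub N n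
    push_cast
    linear_combination 2 * this

/-- Pattern counts in `S_n(132,213,231)` for `n ≥ 3`:
`f_{123} = f_{312} = C(n+1,4)` and `f_{321} = n(n−2)(n−1)²/12`. -/
theorem stmt_17 (n : ℕ) (hn : 3 ≤ n) :
    (fCnt n p123 [p132, p213, p231] = (n + 1).choose 4 ∧
     fCnt n p312 [p132, p213, p231] = (n + 1).choose 4) ∧
    12 * fCnt n p321 [p132, p213, p231] = n * (n - 2) * (n - 1) ^ 2 := by
  have hn0 : 0 < n := by omega
  refine ⟨⟨?_, ?_⟩, ?_⟩
  · rw [fCnt_eq_sum n hn0 _ p123_injective, ← sum_range_choose_succ]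
    refine Finset.sum_congr rfl fun l hl => ?_
    rw [← sum_range_choose_succ]
    refine Finset.sum_congr rfl fun j hj => ?_
    rw [← sum_range_choose_succ]
    refine Finset.sum_congr rfl fun i hi => ?_
    rw [Finset.mem_range] at hl hj hi
    rw [Nat.choose_one_right, ← Finset.card_range (i + 1)]
    congr 1
    ext m
    simp [p123]
    omega
  · rw [fCnt_eq_sum n hn0 _ p312_injective, ← sum_range_choose_succ]
    refine Finset.sum_congr rfl fun l hl => ?_
    rw [← sum_range_choose_succ]
    refine Finset.sum_congr rfl fun j hj => ?_
    rw [← sum_range_choose_succ, ← Finset.sum_range_reflect]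
    refine Finset.sum_congr rfl fun i hi => ?_
    rw [Finset.mem_range] at hl hj hi
    rw [Nat.choose_one_right, show i + 1 = #(Finset.Ioc (j - 1 - i) j) by
      rw [Nat.card_Ioc]; omega]
    congr 1
    ext m
    simp [p312]
    omega
  · have h : fCnt n p321 [p132, p213, p231] =
        ∑ l ∈ range n, ∑ j ∈ range l, j * (n - 1 - j) := by
      rw [fCnt_eq_sum n hn0 _ p321_injective]
      refine Finset.sum_congr rfl fun l hl => Finset.sum_congr rfl fun j hj => ?_
      refine (Finset.sum_const_nat fun i hi => ?_).trans (by rw [Finset.card_range])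
      rw [Finset.mem_range] at hl hj hi
      rw [← Nat.card_Ioo j n |>.trans (by omega : n - j - 1 = n - 1 - j)]
      congr 1
      ext m
      simp [p321]
      omega
    have hcast : ((∑ l ∈ range n, ∑ j ∈ range l, j * (n - 1 - j) : ℕ) : ℤ) =
        ∑ l ∈ range n, ∑ j ∈ range l, (j : ℤ) * ((n - 1 : ℕ) - j) := by
      push_cast
      refine Finset.sum_congr rfl fun l hl => Finset.sum_congr rfl fun j hj => ?_
      rw [Finset.mem_range] at hl hj
      rw [Nat.cast_sub (by omega)]
    rw [h]
    zify [show 2 ≤ n by omega, show 1 ≤ n by omega]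
    have := sum_range_sum_range_mul_sub (n - 1) n
    rw [← hcast] at this
    push_cast [show 1 ≤ n by omega] at this ⊢
    rw [this]
    ring
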